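/- arXiv:2208.10110 — 2 statements merged into one kernel-verified Lean document; each statement's English description precedes it below -/
import Mathlib

section
/- Let s ≥ 1, n = st with t even, P = ⌈log₂(4n/s)⌉, and assume 2Ps divides n. Let a ∈ {0,…,t−1}, c1,c2 ∈ {0,…,2Ps−1}, d1,d2 ∈ {0,…,(2s)!−1}, and let C_s^1(n;a;c1,c2;d1,d2) be the set of all permutations σ of {1,…,n} such that: (i) α(σ_{(s,1)}) ∈ VT_a(t−1); (ii) every run of α(σ_{(s,1)}) has length at most P−1; (iii) σ ∈ C^retrieve_{c1,c2}(n,s,P); and (iv) σ ∈ C^recover_{d1,d2}(n,s). Then C_s^1 corrects a burst stable deletion of length s: for all σ, τ ∈ C_s^1(n;a;c1,c2;d1,d2) and all intervals [i,i+s−1], [i′,i′+s−1] ⊆ [1,n], if the burst stable deletion of length s at [i,i+s−1] applied to σ produces the same sequence as the burst stable deletion of length s at [i′,i′+s−1] applied to τ, then σ = τ. -/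
namespace Stmt

def sig {α : Type*} [LinearOrder α] (u : ℕ → α) : ℕ → ℕ :=
  fun i => if u i ≤ u (i+1) then 1 else 0

def row1 {α : Type*} (s : ℕ) (u : ℕ → α) : ℕ → α :=
  fun i => u ((i-1)*s + 1)

def betaProj {α : Type*} [LinearOrder α] (u : ℕ → α) (m i : ℕ) : ℕ :=
  ((Finset.Icc 1 m).filter (fun j => u j < u i)).card
  + ((Finset.Icc 1 i).filter (fun j => u j = u i)).card

def blockAt {α : Type*} (u : ℕ → α) (L t k : ℕ) : ℕ → α :=
  fun j => u (((k-1) % t) * L + j)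

def pairBlk {α : Type*} (u : ℕ → α) (L t k : ℕ) : ℕ → α :=
  fun j => if j ≤ L then blockAt u L t k j else blockAt u L t (k+1) (j - L)

def rowSumBeta {α : Type*} [LinearOrder α] (s P : ℕ) (v : ℕ → α) : ℕ :=
  ∑ i ∈ Finset.range (2*P), betaProj v (2*P*s) (i*s+1)

def CRetrieve {α : Type*} [LinearOrder α] (n s P c1 c2 : ℕ) (u : ℕ → α) : Prop :=
  (∑ i ∈ Finset.Icc 1 (n/(2*P*s)),
      rowSumBeta s P (pairBlk u (P*s) (n/(P*s)) (2*i-1))) ≡ c1 [MOD 2*P*s]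
  ∧ (∑ i ∈ Finset.Icc 1 (n/(2*P*s)),
      rowSumBeta s P (pairBlk u (P*s) (n/(P*s)) (2*i))) ≡ c2 [MOD 2*P*s]

def permRank {α : Type*} [LinearOrder α] (u : ℕ → α) (m : ℕ) : ℕ :=
  1 + (((List.range' 1 m).permutations).filter
    (fun l => decide (List.Lex (· < ·) l
      ((List.range' 1 m).map (fun i => betaProj u m i))))).length

def CRecover {α : Type*} [LinearOrder α] (n h d1 d2 : ℕ) (u : ℕ → α) : Prop :=
  (∑ i ∈ Finset.Icc 1 (n/(2*h)), permRank (pairBlk u h (n/h) (2*i-1)) (2*h))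
      ≡ d1 [MOD Nat.factorial (2*h)]
  ∧ (∑ i ∈ Finset.Icc 1 (n/(2*h)), permRank (pairBlk u h (n/h) (2*i)) (2*h))
      ≡ d2 [MOD Nat.factorial (2*h)]

def BurstDelEq {α : Type*} (n s : ℕ) (x y : ℕ → α) (i i' : ℕ) : Prop :=
  ∀ j ∈ Finset.Icc 1 (n - s),
    (if j < i then x j else x (j + s)) = (if j < i' then y j else y (j + s))

def NoRun (m P : ℕ) (y : ℕ → ℕ) : Prop :=
  ∀ i, 1 ≤ i → i + P - 1 ≤ m → ∃ j, i ≤ j ∧ j + 1 ≤ i + P - 1 ∧ y j ≠ y (j+1)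

def seqOf (n : ℕ) (π : Equiv.Perm (Fin n)) : ℕ → ℕ :=
  fun i => if h : i - 1 < n then (π ⟨i-1, h⟩ : ℕ) + 1 else 0

def insSeq (π : ℕ → ℕ) (j v : ℕ) : ℕ → ℕ :=
  fun i => if i ≤ j then π i else if i = j+1 then v else π (i-1)


/-! ### Deleting an element from the first row -/

theorem sig_le_one (u : ℕ → ℕ) (j : ℕ) : sig u j = 0 ∨ sig u j = 1 := by
  unfold sig; split_ifs <;> simp

theorem sig_del (t p : ℕ) (ht : 2 ≤ t) (hp : 1 ≤ p) (hpt : p ≤ t) (x : ℕ → ℕ) :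
    ∃ q, 1 ≤ q ∧ q ≤ t - 1 ∧ (q = p ∨ q + 1 = p) ∧
      ∀ j, 1 ≤ j → j ≤ t - 2 →
        sig (fun j => if j < p then x j else x (j+1)) j
          = if j < q then sig x j else sig x (j+1) := by
  have key : ∀ j, j + 1 ≠ p → sig (fun j => if j < p then x j else x (j+1)) j
      = if j < p then sig x j else sig x (j+1) := by
    intro j hj
    unfold sig
    by_cases h : j < p
    · have h' : j + 1 < p := by omega
      simp [h, h']
    · have h' : ¬ j + 1 < p := by omega
      simp [h, h']
  by_cases h1 : p = 1
  · refine ⟨1, le_refl _, by omega, Or.inl h1.symm, ?_⟩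
    intro j hj hj2
    rw [key j (by omega), h1]
  by_cases h2 : p = t
  · refine ⟨t - 1, by omega, le_refl _, Or.inr (by omega), ?_⟩
    intro j hj hj2
    rw [key j (by omega), if_pos (by omega), if_pos (by omega)]
  obtain ⟨p, rfl⟩ : ∃ p', p = p' + 1 := ⟨p - 1, by omega⟩
  have hcase : sig (fun j => if j < p + 1 then x j else x (j+1)) p = sig x p ∨
      sig (fun j => if j < p + 1 then x j else x (j+1)) p = sig x (p+1) := by
    unfold sig
    have : ¬ (p + 1 < p + 1) := by omega
    simp only [lt_add_iff_pos_right, this, if_false]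
    simp only [zero_lt_one, if_true]
    split_ifs <;> first | omega | simp
  rcases hcase with hc | hc
  · refine ⟨p + 1, by omega, by omega, Or.inl rfl, ?_⟩
    intro j hj hj2
    by_cases hjp : j = p
    · subst hjp; rw [hc, if_pos (by omega)]
    · exact key j (by omega)
  · refine ⟨p, by omega, by omega, Or.inr rfl, ?_⟩
    intro j hj hj2
    by_cases hjp : j = p
    · subst hjp; rw [hc, if_neg (by omega)]
    · rw [key j (by omega)]
      by_cases h : j < p
      · rw [if_pos h, if_pos (by omega)]
      · rw [if_neg h, if_neg (by omega)]

/-! ### The Varshamov-Tenengolts argument -/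

theorem vt_shift (u v : ℕ → ℕ) (q : ℕ) (d : ℕ) (hq : 1 ≤ q)
    (h1 : ∀ j, 1 ≤ j → j < q → u j = v j)
    (h2 : ∀ j, q ≤ j → j < q + d → u (j+1) = v j) :
    ∑ j ∈ Finset.Icc 1 (q+d), j * u j + (q + d) * v (q + d)
      = ∑ j ∈ Finset.Icc 1 (q+d), j * v j + q * u q + ∑ j ∈ Finset.Icc (q+1) (q+d), u j := by
  induction d with
  | zero =>
    obtain ⟨q, rfl⟩ : ∃ q', q = q' + 1 := ⟨q - 1, by omega⟩
    have : ∑ j ∈ Finset.Icc 1 q, j * u j = ∑ j ∈ Finset.Icc 1 q, j * v j := by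
      apply Finset.sum_congr rfl
      intro j hj
      rw [Finset.mem_Icc] at hj
      rw [h1 j hj.1 (by omega)]
    simp only [add_zero]
    rw [Finset.sum_Icc_succ_top (by omega), Finset.sum_Icc_succ_top (by omega), this,
      Finset.Icc_eq_empty (by omega : ¬ (q + 1 + 1 ≤ q + 1))]
    simp only [Finset.sum_empty]
    omega
  | succ d ih =>
    have ih := ih (fun j hj hj2 => h2 j hj (by omega))
    have e := h2 (q + d) (by omega) (by omega)
    rw [← add_assoc, Finset.sum_Icc_succ_top (by omega), Finset.sum_Icc_succ_top (by omega),
      Finset.sum_Icc_succ_top (by omega)]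
    rw [e] at *
    nlinarith [ih]

theorem vt_one (m q d : ℕ) (u v : ℕ → ℕ) (hu : ∀ j, u j = 0 ∨ u j = 1)
    (hv : ∀ j, v j = 0 ∨ v j = 1) (hq : 1 ≤ q) (hqm : q + d ≤ m)
    (h1 : ∀ j, 1 ≤ j → j < q → u j = v j)
    (h2 : ∀ j, q ≤ j → j < q + d → u (j+1) = v j)
    (h3 : ∀ j, q + d < j → j ≤ m → u j = v j)
    (hmod : ∑ j ∈ Finset.Icc 1 m, j * u j ≡ ∑ j ∈ Finset.Icc 1 m, j * v j [MOD m+1]) :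
    (∀ j, 1 ≤ j → j ≤ m → u j = v j) ∧ (∀ j, q ≤ j → j ≤ q + d → u j = u q) := by
  have hsh := vt_shift u v q d hq h1 h2
  have hsplit : ∀ w : ℕ → ℕ, ∑ j ∈ Finset.Icc 1 m, j * w j =
      ∑ j ∈ Finset.Icc 1 (q+d), j * w j + ∑ j ∈ Finset.Icc (q+d+1) m, j * w j := by
    intro w
    have e1 : Finset.Icc 1 m = Finset.Ico 1 (m+1) := by ext; simp only [Finset.mem_Icc, Finset.mem_Ico]; omega
    have e2 : Finset.Icc 1 (q+d) = Finset.Ico 1 (q+d+1) := by ext; simp only [Finset.mem_Icc, Finset.mem_Ico]; omega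
    have e3 : Finset.Icc (q+d+1) m = Finset.Ico (q+d+1) (m+1) := by ext; simp only [Finset.mem_Icc, Finset.mem_Ico]; omega
    rw [e1, e2, e3, Finset.sum_Ico_consecutive _ (by omega) (by omega)]
  have htail : ∑ j ∈ Finset.Icc (q+d+1) m, j * u j = ∑ j ∈ Finset.Icc (q+d+1) m, j * v j := by
    apply Finset.sum_congr rfl
    intro j hj
    rw [Finset.mem_Icc] at hj
    rw [h3 j (by omega) hj.2]
  rw [hsplit u, hsplit v, htail] at hmod
  have hmod := Nat.ModEq.add_right_cancel' _ hmod
  set N := ∑ j ∈ Finset.Icc (q+1) (q+d), u j with hN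
  set A := ∑ j ∈ Finset.Icc 1 (q+d), j * u j
  set B := ∑ j ∈ Finset.Icc 1 (q+d), j * v j
  have hNle : N ≤ d := by
    have : N ≤ ∑ j ∈ Finset.Icc (q+1) (q+d), 1 := by
      apply Finset.sum_le_sum
      intro j _
      rcases hu j with h | h <;> omega
    simpa using this
  have hmod' : B + q * u q + N ≡ B + (q + d) * v (q+d) [MOD m+1] := by
    have := hmod.add_right ((q + d) * v (q + d))
    rw [hsh] at this
    exact this
  have hm : q * u q + N ≡ (q + d) * v (q+d) [MOD m+1] := by
    rw [add_assoc] at hmod'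
    exact Nat.ModEq.add_left_cancel' _ hmod'
  have hvu : ∀ c, u q = c → v (q+d) = c → (∀ j, q + 1 ≤ j → j ≤ q + d → u j = c) →
      (∀ j, 1 ≤ j → j ≤ m → u j = v j) ∧ (∀ j, q ≤ j → j ≤ q + d → u j = u q) := by
    intro c hc1 hc2 hc3
    have hall : ∀ j, q ≤ j → j ≤ q + d → u j = c := by
      intro j hj hj2
      by_cases h : j = q
      · rw [h, hc1]
      · exact hc3 j (by omega) hj2
    refine ⟨?_, ?_⟩
    · intro j hj hjm
      by_cases ha : j < q
      · exact h1 j hj ha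
      by_cases hb : q + d < j
      · exact h3 j hb hjm
      by_cases hc : j = q + d
      · rw [hall j (by omega) (by omega), hc, hc2]
      · rw [hall j (by omega) (by omega), ← h2 j (by omega) (by omega),
          hall (j+1) (by omega) (by omega)]
    · intro j hj hj2
      rw [hall j hj hj2, hc1]
  rcases hu q with hu0 | hu1 <;> rcases hv (q+d) with hv0 | hv1
  · rw [hu0, hv0] at hm
    simp only [mul_zero, zero_add] at hm
    have hN0 : N = 0 := Nat.ModEq.eq_of_lt_of_lt hm (by omega) (by omega)
    apply hvu 0 hu0 hv0
    intro j hj hj2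
    exact (Finset.sum_eq_zero_iff.mp hN0) j (Finset.mem_Icc.mpr ⟨hj, hj2⟩)
  · rw [hu0, hv1] at hm
    simp only [mul_zero, zero_add, mul_one] at hm
    have := Nat.ModEq.eq_of_lt_of_lt hm (by omega) (by omega)
    omega
  · rw [hu1, hv0] at hm
    simp only [mul_zero, mul_one] at hm
    have := Nat.ModEq.eq_of_lt_of_lt hm (by omega) (by omega)
    omega
  · rw [hu1, hv1] at hm
    simp only [mul_one] at hm
    have hNd := Nat.ModEq.eq_of_lt_of_lt hm (by omega) (by omega)
    apply hvu 1 hu1 hv1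
    intro j hj hj2
    have hs : ∑ j ∈ Finset.Icc (q+1) (q+d), u j = ∑ j ∈ Finset.Icc (q+1) (q+d), 1 := by
      simp
      omega
    exact (Finset.sum_eq_sum_iff_of_le (by
      intro j _
      rcases hu j with h | h <;> omega)).mp hs j (Finset.mem_Icc.mpr ⟨hj, hj2⟩)

/-- deletion at `q` and `q'` (in any order) -/
theorem vt_two (m q q' : ℕ) (u v : ℕ → ℕ) (hu : ∀ j, u j = 0 ∨ u j = 1)
    (hv : ∀ j, v j = 0 ∨ v j = 1) (hq : 1 ≤ q) (hqm : q ≤ m) (hq' : 1 ≤ q') (hqm' : q' ≤ m)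
    (h : ∀ j, 1 ≤ j → j ≤ m - 1 →
      (if j < q then u j else u (j+1)) = (if j < q' then v j else v (j+1)))
    (hmod : ∑ j ∈ Finset.Icc 1 m, j * u j ≡ ∑ j ∈ Finset.Icc 1 m, j * v j [MOD m+1]) :
    (∀ j, 1 ≤ j → j ≤ m → u j = v j) ∧ (∀ j, q ≤ j → j ≤ q' → u j = u q) := by
  rcases le_total q q' with hle | hle
  · obtain ⟨d, rfl⟩ := Nat.exists_eq_add_of_le hle
    apply vt_one m q d u v hu hv hq hqm' _ _ _ hmod
    · intro j hj hjq
      have := h j hj (by omega)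
      rwa [if_pos hjq, if_pos (by omega)] at this
    · intro j hj hjq
      have := h j (by omega) (by omega)
      rwa [if_neg (by omega), if_pos hjq] at this
    · intro j hj hjm
      obtain ⟨j, rfl⟩ : ∃ j', j = j' + 1 := ⟨j - 1, by omega⟩
      have := h j (by omega) (by omega)
      rwa [if_neg (by omega), if_neg (by omega)] at this
  · obtain ⟨d, rfl⟩ := Nat.exists_eq_add_of_le hle
    have := vt_one m q' d v u hv hu hq' hqm ?_ ?_ ?_ hmod.symm
    · refine ⟨fun j hj hj2 => (this.1 j hj hj2).symm, fun j hj hj2 => ?_⟩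
      have : j = q' + d := by omega
      rw [this]
    · intro j hj hjq
      have := h j hj (by omega)
      rw [if_pos (by omega), if_pos hjq] at this
      exact this.symm
    · intro j hj hjq
      have := h j (by omega) (by omega)
      rw [if_pos hjq, if_neg (by omega)] at this
      exact this.symm
    · intro j hj hjm
      obtain ⟨j, rfl⟩ : ∃ j', j = j' + 1 := ⟨j - 1, by omega⟩
      have := h j (by omega) (by omega)
      rw [if_neg (by omega), if_neg (by omega)] at this
      exact this.symm

/-! ### The row cannot move once the deleted value is known -/

theorem row_fixed (t p p' : ℕ) (x y : ℕ → ℕ) (hp : 1 ≤ p) (hpp : p ≤ p') (hpt : p' ≤ t)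
    (hinj : ∀ j k, 1 ≤ j → j ≤ t → 1 ≤ k → k ≤ t → x j = x k → j = k)
    (h2 : ∀ j, p ≤ j → j < p' → x (j+1) = y j)
    (hsig : ∀ j, 1 ≤ j → j ≤ t - 1 → sig x j = sig y j)
    (hval : x p = y p') : p = p' := by
  by_contra hne
  have hlt : p < p' := by omega
  have hstep : ∀ j, p ≤ j → j + 1 < p' → sig x j = sig x (j+1) := by
    intro j hj hj2
    rw [hsig j (by omega) (by omega)]
    unfold sig
    rw [← h2 j hj (by omega), ← h2 (j+1) (by omega) hj2]
  have hlast : sig x (p' - 1) = if x p' ≤ x p then 1 else 0 := by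
    rw [hsig _ (by omega) (by omega)]
    unfold sig
    rw [← h2 (p'-1) (by omega) (by omega)]
    have : p' - 1 + 1 = p' := by omega
    rw [this, hval]
  have hconst : ∀ d, p + d < p' → sig x (p + d) = sig x p := by
    intro d
    induction d with
    | zero => intro _; rfl
    | succ d ih =>
      intro hd
      rw [← add_assoc, ← hstep (p+d) (by omega) (by omega), ih (by omega)]
  have hL : sig x (p' - 1) = sig x p := by
    have := hconst (p' - 1 - p) (by omega)
    have e : p + (p' - 1 - p) = p' - 1 := by omega
    rwa [e] at this
  have hne' : x p ≠ x p' := fun h => hne (hinj p p' hp (by omega) (by omega) hpt h)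
  have e : p + (p' - p) = p' := by omega
  rcases sig_le_one x p with h0 | h1
  · have hmono : ∀ d, p + d ≤ p' → x (p+d) ≤ x p := by
      intro d
      induction d with
      | zero => intro _; exact le_refl _
      | succ d ih =>
        intro hd
        have a := ih (by omega)
        have b := hconst d (by omega)
        rw [h0] at b
        unfold sig at b
        split_ifs at b with hb
        rw [← add_assoc]
        omega
    have := hmono (p' - p) (by omega)
    rw [e] at this
    rw [hL, h0, if_pos this] at hlast
    omega
  · have hmono : ∀ d, p + d ≤ p' → x p ≤ x (p+d) := by
      intro d
      induction d with
      | zero => intro _; exact le_refl _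
      | succ d ih =>
        intro hd
        have a := ih (by omega)
        have b := hconst d (by omega)
        rw [h1] at b
        unfold sig at b
        split_ifs at b with hb
        rw [← add_assoc]
        omega
    have := hmono (p' - p) (by omega)
    rw [e] at this
    rw [hL, h1, if_neg (by omega)] at hlast
    omega

/-! ### Sums along a moved row -/

theorem sum_move (f : ℕ → ℕ) (x y : ℕ → ℕ) (B p p' E : ℕ) (hB : B ≤ p) (hpp : p ≤ p')
    (hE : p' < E)
    (h1 : ∀ j, B ≤ j → j < p → x j = y j)
    (h2 : ∀ j, p ≤ j → j < p' → x (j+1) = y j)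
    (h3 : ∀ j, p' < j → j < E → x j = y j) :
    ∑ j ∈ Finset.Ico B E, f (x j) + f (y p') = ∑ j ∈ Finset.Ico B E, f (y j) + f (x p) := by
  have hA : ∀ d, p + d ≤ p' → ∑ j ∈ Finset.Ico B (p+d+1), f (x j)
      = ∑ j ∈ Finset.Ico B (p+d), f (y j) + f (x p) := by
    intro d
    induction d with
    | zero =>
      intro _
      simp only [add_zero]
      rw [Finset.sum_Ico_succ_top hB]
      congr 1
      apply Finset.sum_congr rfl
      intro j hj
      rw [Finset.mem_Ico] at hj
      rw [h1 j hj.1 hj.2]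
    | succ d ih =>
      intro hd
      rw [← add_assoc, Finset.sum_Ico_succ_top (by omega), ih (by omega),
        Finset.sum_Ico_succ_top (by omega : B ≤ p + d), h2 (p+d) (by omega) (by omega)]
      omega
  have hA' := hA (p' - p) (by omega)
  have e : p + (p' - p) = p' := by omega
  rw [e] at hA'
  have ht : ∑ j ∈ Finset.Ico (p'+1) E, f (x j) = ∑ j ∈ Finset.Ico (p'+1) E, f (y j) := by
    apply Finset.sum_congr rfl
    intro j hj
    rw [Finset.mem_Ico] at hj
    rw [h3 j (by omega) hj.2]
  rw [← Finset.sum_Ico_consecutive _ (by omega : B ≤ p' + 1) (by omega : p' + 1 ≤ E),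
    ← Finset.sum_Ico_consecutive (fun j => f (y j)) (by omega : B ≤ p' + 1)
      (by omega : p' + 1 ≤ E), hA', ht, Finset.sum_Ico_succ_top (by omega : B ≤ p')]
  omega

/-! ### Projections and ranks -/

/-- rank of a value in a finite set -/
def rk (S : Finset ℕ) (z : ℕ) : ℕ := (S.filter (fun a => a < z)).card + 1

theorem rk_le (S : Finset ℕ) (z : ℕ) (hz : z ∈ S) : rk S z ≤ S.card := by
  unfold rk
  apply Nat.succ_le_of_lt
  apply Finset.card_lt_card
  rw [Finset.ssubset_iff_of_subset (Finset.filter_subset _ _)]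
  exact ⟨z, hz, by simp⟩

theorem rk_lt (S : Finset ℕ) (z w : ℕ) (hz : z ∈ S) (h : z < w) : rk S z < rk S w := by
  unfold rk
  apply Nat.succ_lt_succ
  apply Finset.card_lt_card
  rw [Finset.ssubset_iff_of_subset]
  · exact ⟨z, by simp [hz, h], by simp⟩
  · intro a
    simp only [Finset.mem_filter]
    rintro ⟨h1, h2⟩
    exact ⟨h1, by omega⟩

theorem rk_inj (S : Finset ℕ) (z w : ℕ) (hz : z ∈ S) (hw : w ∈ S) (h : rk S z = rk S w) :
    z = w := by
  rcases lt_trichotomy z w with h1 | h1 | h1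
  · have := rk_lt S z w hz h1; omega
  · exact h1
  · have := rk_lt S w z hw h1; omega

theorem betaProj_eq (v : ℕ → ℕ) (m i : ℕ) (hv : Set.InjOn v (Finset.Icc 1 m : Finset ℕ))
    (hi : 1 ≤ i) (him : i ≤ m) :
    betaProj v m i = rk ((Finset.Icc 1 m).image v) (v i) := by
  unfold betaProj rk
  congr 1
  · rw [Finset.filter_image, Finset.card_image_of_injOn]
    exact hv.mono (Finset.coe_subset.mpr (Finset.filter_subset _ _))
  · have : (Finset.Icc 1 i).filter (fun j => v j = v i) = {i} := by
      ext j
      simp only [Finset.mem_filter, Finset.mem_Icc, Finset.mem_singleton]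
      constructor
      · rintro ⟨⟨h1, h2⟩, h3⟩
        exact hv (by simp; omega) (by simp; omega) h3
      · rintro rfl
        exact ⟨⟨hi, le_refl _⟩, rfl⟩
    rw [this, Finset.card_singleton]

theorem betaProj_congr (v w : ℕ → ℕ) (m i : ℕ) (h : ∀ j, 1 ≤ j → j ≤ m → v j = w j)
    (hi : 1 ≤ i) (him : i ≤ m) : betaProj v m i = betaProj w m i := by
  unfold betaProj
  rw [h i hi him]
  congr 2
  · apply Finset.filter_congr
    intro j hj
    rw [Finset.mem_Icc] at hj
    rw [h j hj.1 hj.2]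
  · apply Finset.filter_congr
    intro j hj
    rw [Finset.mem_Icc] at hj
    rw [h j hj.1 (by omega)]

theorem rowSumBeta_congr (s P : ℕ) (hs : 1 ≤ s) (v w : ℕ → ℕ)
    (h : ∀ j, 1 ≤ j → j ≤ 2 * (P * s) → v j = w j) :
    rowSumBeta s P v = rowSumBeta s P w := by
  unfold rowSumBeta
  apply Finset.sum_congr rfl
  intro i hi
  rw [Finset.mem_range] at hi
  have h1 : i * s + s ≤ 2 * P * s := by
    have := Nat.mul_le_mul_right s (Nat.succ_le_of_lt hi)
    rwa [Nat.succ_mul] at this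
  apply betaProj_congr _ _ _ _ _ (by omega) (by omega)
  rwa [← mul_assoc] at h

theorem permRank_congr (m : ℕ) (v w : ℕ → ℕ)
    (h : ∀ j, 1 ≤ j → j ≤ m → v j = w j) :
    permRank v m = permRank w m := by
  unfold permRank
  have : (List.range' 1 m).map (fun i => betaProj v m i)
      = (List.range' 1 m).map (fun i => betaProj w m i) := by
    apply List.map_congr_left
    intro i hi
    rw [List.mem_range'_1] at hi
    exact betaProj_congr v w m i h (by omega) (by omega)
  rw [this]

theorem beta_perm (v : ℕ → ℕ) (m : ℕ) (hv : Set.InjOn v (Finset.Icc 1 m : Finset ℕ)) :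
    (List.range' 1 m).map (fun i => betaProj v m i) ∈ (List.range' 1 m).permutations := by
  rw [List.mem_permutations]
  have hcard : ((Finset.Icc 1 m).image v).card = m := by
    rw [Finset.card_image_of_injOn hv]; simp
  have hmem : ∀ i, 1 ≤ i → i ≤ m → v i ∈ (Finset.Icc 1 m).image v := fun i h1 h2 =>
    Finset.mem_image_of_mem v (by simp; omega)
  apply List.Subperm.perm_of_length_le
  · apply List.subperm_of_subset
    · apply List.Nodup.map_on _ List.nodup_range'
      intro a ha b hb hab
      rw [List.mem_range'_1] at ha hb
      rw [betaProj_eq v m a hv (by omega) (by omega),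
        betaProj_eq v m b hv (by omega) (by omega)] at hab
      exact hv (by simp; omega) (by simp; omega)
        (rk_inj _ _ _ (hmem a (by omega) (by omega)) (hmem b (by omega) (by omega)) hab)
    · intro z hz
      rw [List.mem_map] at hz
      obtain ⟨a, ha, rfl⟩ := hz
      rw [List.mem_range'_1] at ha ⊢
      rw [betaProj_eq v m a hv (by omega) (by omega)]
      have := rk_le _ _ (hmem a (by omega) (by omega))
      have h1 : 1 ≤ rk ((Finset.Icc 1 m).image v) (v a) := by unfold rk; omega
      omega
  · simp

/-- number of permutations below a given list -/
def below (m : ℕ) (l : List ℕ) : ℕ :=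
  (((List.range' 1 m).permutations).filter (fun l' => decide (List.Lex (· < ·) l' l))).length

theorem below_eq (m : ℕ) (l : List ℕ) :
    below m l = (((List.range' 1 m).permutations.toFinset).filter (fun l' => l' < l)).card := by
  unfold below
  have hnd : ((List.range' 1 m).permutations).Nodup :=
    List.nodup_permutations _ List.nodup_range'
  rw [← List.toFinset_card_of_nodup (hnd.filter _), List.toFinset_filter]
  congr 1
  apply Finset.filter_congr
  intro a _
  simp only [decide_eq_true_eq]
  exact Iff.rfl

theorem below_lt (m : ℕ) (l l' : List ℕ) (hl : l ∈ (List.range' 1 m).permutations)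
    (h : l < l') : below m l < below m l' := by
  rw [below_eq, below_eq]
  apply Finset.card_lt_card
  rw [Finset.ssubset_iff_of_subset]
  · exact ⟨l, by simp only [Finset.mem_filter, List.mem_toFinset]; exact ⟨hl, h⟩, by simp⟩
  · intro a
    simp only [Finset.mem_filter]
    rintro ⟨h1, h2⟩
    exact ⟨h1, lt_trans h2 h⟩

theorem below_bound (m : ℕ) (l : List ℕ) (hl : l ∈ (List.range' 1 m).permutations) :
    below m l < Nat.factorial m := by
  rw [below_eq]
  have hnd : ((List.range' 1 m).permutations).Nodup :=
    List.nodup_permutations _ List.nodup_range'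
  have hc : ((List.range' 1 m).permutations.toFinset).card = Nat.factorial m := by
    rw [List.toFinset_card_of_nodup hnd, List.length_permutations]; simp
  rw [← hc]
  apply Finset.card_lt_card
  rw [Finset.ssubset_iff_of_subset (Finset.filter_subset _ _)]
  exact ⟨l, by rwa [List.mem_toFinset], by simp⟩

theorem permRank_recover (m : ℕ) (v w : ℕ → ℕ)
    (hv : Set.InjOn v (Finset.Icc 1 m : Finset ℕ)) (hw : Set.InjOn w (Finset.Icc 1 m : Finset ℕ))
    (himg : (Finset.Icc 1 m).image v = (Finset.Icc 1 m).image w)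
    (h : permRank v m ≡ permRank w m [MOD Nat.factorial m]) :
    ∀ j, 1 ≤ j → j ≤ m → v j = w j := by
  have hv' := beta_perm v m hv
  have hw' := beta_perm w m hw
  have h' : 1 + below m ((List.range' 1 m).map (fun i => betaProj v m i)) ≡
    1 + below m ((List.range' 1 m).map (fun i => betaProj w m i)) [MOD Nat.factorial m] := h
  have h2 := Nat.ModEq.eq_of_lt_of_lt (Nat.ModEq.add_left_cancel' 1 h')
    (below_bound m _ hv') (below_bound m _ hw')
  have heq : (List.range' 1 m).map (fun i => betaProj v m i)
      = (List.range' 1 m).map (fun i => betaProj w m i) := by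
    rcases lt_trichotomy ((List.range' 1 m).map (fun i => betaProj v m i))
      ((List.range' 1 m).map (fun i => betaProj w m i)) with h1 | h1 | h1
    · have := below_lt m _ _ hv' h1; omega
    · exact h1
    · have := below_lt m _ _ hw' h1; omega
  intro j hj hjm
  have hb : betaProj v m j = betaProj w m j :=
    (List.map_inj_left.mp heq) j (by rw [List.mem_range'_1]; omega)
  rw [betaProj_eq v m j hv hj hjm, betaProj_eq w m j hw hj hjm, ← himg] at hb
  refine rk_inj _ _ _ (Finset.mem_image_of_mem v (by simp; omega)) ?_ hb
  rw [himg]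
  exact Finset.mem_image_of_mem w (by simp; omega)

/-! ### Isolating one pair of blocks -/

theorem blockAt_agree (σ τ : ℕ → ℕ) (L T k b : ℕ) (hT : 1 ≤ T)
    (hagree : ∀ l, 1 ≤ l → l ≤ L * T → (l ≤ (k-1)*L ∨ (k+1)*L < l) → σ l = τ l)
    (hb1 : (b - 1) % T + 1 < k ∨ k < (b-1) % T) (j : ℕ) (hj : 1 ≤ j) (hjL : j ≤ L) :
    blockAt σ L T b j = blockAt τ L T b j := by
  unfold blockAt
  have hlt : (b - 1) % T < T := Nat.mod_lt _ hT
  generalize (b - 1) % T = c at *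
  have h0 : (c + 1) * L ≤ T * L := Nat.mul_le_mul_right L hlt
  rw [Nat.succ_mul] at h0
  apply hagree
  · omega
  · rw [mul_comm L T]; omega
  · rcases hb1 with h | h
    · left
      have := Nat.mul_le_mul_right L (show c + 1 ≤ k - 1 by omega)
      rw [Nat.succ_mul] at this
      omega
    · right
      have := Nat.mul_le_mul_right L (show k + 1 ≤ c by omega)
      omega

theorem pairBlk_agree (σ τ : ℕ → ℕ) (L T k b : ℕ) (hb : 1 ≤ b) (hbT : b ≤ T)
    (hk : 1 ≤ k) (hkT : k < T) (hpar : b % 2 = k % 2) (hT2 : T % 2 = 0) (hne : b ≠ k)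
    (hagree : ∀ l, 1 ≤ l → l ≤ L * T → (l ≤ (k-1)*L ∨ (k+1)*L < l) → σ l = τ l)
    (j : ℕ) (hj : 1 ≤ j) (hjL : j ≤ 2 * L) :
    pairBlk σ L T b j = pairBlk τ L T b j := by
  unfold pairBlk
  split_ifs with h
  · apply blockAt_agree σ τ L T k b (by omega) hagree _ j hj h
    rw [Nat.mod_eq_of_lt (by omega)]
    omega
  · apply blockAt_agree σ τ L T k (b+1) (by omega) hagree _ (j - L) (by omega) (by omega)
    by_cases hb' : b = T
    · subst hb'
      simp
      omega
    · rw [Nat.mod_eq_of_lt (by omega)]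
      omega

theorem pairBlk_val (σ : ℕ → ℕ) (L T k : ℕ) (hk : 1 ≤ k) (hkT : k < T) (j : ℕ) :
    pairBlk σ L T k j = σ ((k-1)*L + j) := by
  unfold pairBlk blockAt
  rw [Nat.mod_eq_of_lt (by omega), Nat.mod_eq_of_lt (by omega)]
  split_ifs with h
  · rfl
  · congr 1
    obtain ⟨k, rfl⟩ : ∃ k', k = k' + 1 := ⟨k - 1, by omega⟩
    simp only [Nat.add_sub_cancel]
    rw [Nat.succ_mul]
    omega

theorem sum_isolate (s : Finset ℕ) (f g : ℕ → ℕ) (M c b : ℕ) (hb : b ∈ s)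
    (hfg : ∀ i ∈ s, i ≠ b → f i = g i)
    (h1 : ∑ i ∈ s, f i ≡ c [MOD M]) (h2 : ∑ i ∈ s, g i ≡ c [MOD M]) : f b ≡ g b [MOD M] := by
  have h := h1.trans h2.symm
  rw [← Finset.add_sum_erase s f hb, ← Finset.add_sum_erase s g hb] at h
  have e : ∑ i ∈ s.erase b, f i = ∑ i ∈ s.erase b, g i := by
    apply Finset.sum_congr rfl
    intro i hi
    rw [Finset.mem_erase] at hi
    exact hfg i hi.2 hi.1
  rw [e] at h
  exact Nat.ModEq.add_right_cancel' _ h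

theorem pair_mod (σ τ : ℕ → ℕ) (L T H M k c1 c2 : ℕ) (F : (ℕ → ℕ) → ℕ)
    (hF : ∀ v w : ℕ → ℕ, (∀ j, 1 ≤ j → j ≤ 2 * L → v j = w j) → F v = F w)
    (hTH : T = 2 * H) (hk : 1 ≤ k) (hkT : k < T)
    (hagree : ∀ l, 1 ≤ l → l ≤ L * T → (l ≤ (k-1)*L ∨ (k+1)*L < l) → σ l = τ l)
    (hσ1 : ∑ i ∈ Finset.Icc 1 H, F (pairBlk σ L T (2*i-1)) ≡ c1 [MOD M])
    (hτ1 : ∑ i ∈ Finset.Icc 1 H, F (pairBlk τ L T (2*i-1)) ≡ c1 [MOD M])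
    (hσ2 : ∑ i ∈ Finset.Icc 1 H, F (pairBlk σ L T (2*i)) ≡ c2 [MOD M])
    (hτ2 : ∑ i ∈ Finset.Icc 1 H, F (pairBlk τ L T (2*i)) ≡ c2 [MOD M]) :
    F (fun j => σ ((k-1)*L + j)) ≡ F (fun j => τ ((k-1)*L + j)) [MOD M] := by
  have e : ∀ u : ℕ → ℕ, F (fun j => u ((k-1)*L + j)) = F (pairBlk u L T k) := by
    intro u
    apply hF
    intro j _ _
    rw [pairBlk_val u L T k hk hkT]
  rw [e, e]
  rcases Nat.even_or_odd' k with ⟨b, hb | hb⟩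
  · have := sum_isolate _ (fun i => F (pairBlk σ L T (2*i))) (fun i => F (pairBlk τ L T (2*i)))
      M c2 b (by simp; omega : b ∈ Finset.Icc 1 H) ?_ hσ2 hτ2
    · simpa only [← hb] using this
    · intro i hi hib
      rw [Finset.mem_Icc] at hi
      apply hF
      intro j hj hjL
      exact pairBlk_agree σ τ L T k (2*i) (by omega) (by omega) hk hkT (by omega) (by omega)
        (by omega) hagree j hj hjL
  · have := sum_isolate _ (fun i => F (pairBlk σ L T (2*i-1)))
      (fun i => F (pairBlk τ L T (2*i-1)))
      M c1 (b+1) (by simp; omega : b + 1 ∈ Finset.Icc 1 H) ?_ hσ1 hτ1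
    · have e2 : 2 * (b + 1) - 1 = k := by omega
      simpa only [e2] using this
    · intro i hi hib
      rw [Finset.mem_Icc] at hi
      apply hF
      intro j hj hjL
      exact pairBlk_agree σ τ L T k (2*i-1) (by omega) (by omega) hk hkT (by omega) (by omega)
        (by omega) hagree j hj hjL

/-! ### Windows of permutations -/

theorem window_inj (σ : ℕ → ℕ) (n A m : ℕ) (hσ : Set.BijOn σ (Set.Icc 1 n) (Set.Icc 1 n))
    (hA : A + m ≤ n) : Set.InjOn (fun j => σ (A + j)) (Finset.Icc 1 m : Finset ℕ) := by
  intro a ha b hb hab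
  simp only [Finset.coe_Icc, Set.mem_Icc] at ha hb
  have := hσ.injOn (Set.mem_Icc.mpr (by omega)) (Set.mem_Icc.mpr (by omega)) hab
  omega

theorem window_sub (σ τ : ℕ → ℕ) (n A m : ℕ) (hσ : Set.BijOn σ (Set.Icc 1 n) (Set.Icc 1 n))
    (hτ : Set.BijOn τ (Set.Icc 1 n) (Set.Icc 1 n)) (hA : A + m ≤ n)
    (hagree : ∀ l, 1 ≤ l → l ≤ n → (l ≤ A ∨ A + m < l) → σ l = τ l) :
    (Finset.Icc 1 m).image (fun j => σ (A + j)) ⊆ (Finset.Icc 1 m).image (fun j => τ (A + j)) := by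
  intro z hz
  rw [Finset.mem_image] at hz ⊢
  obtain ⟨a, ha, rfl⟩ := hz
  rw [Finset.mem_Icc] at ha
  have hm := hσ.mapsTo (Set.mem_Icc.mpr (⟨by omega, by omega⟩ : 1 ≤ A + a ∧ A + a ≤ n))
  obtain ⟨l, hl, hlz⟩ := hτ.surjOn hm
  rw [Set.mem_Icc] at hl
  by_cases h : l ≤ A ∨ A + m < l
  · have := hagree l hl.1 hl.2 h
    rw [← this] at hlz
    have := hσ.injOn (Set.mem_Icc.mpr hl) (Set.mem_Icc.mpr (by omega)) hlz
    omega
  · refine ⟨l - A, by rw [Finset.mem_Icc]; omega, ?_⟩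
    have e : A + (l - A) = l := by omega
    simp only [e, hlz]

theorem window_img (σ τ : ℕ → ℕ) (n A m : ℕ) (hσ : Set.BijOn σ (Set.Icc 1 n) (Set.Icc 1 n))
    (hτ : Set.BijOn τ (Set.Icc 1 n) (Set.Icc 1 n)) (hA : A + m ≤ n)
    (hagree : ∀ l, 1 ≤ l → l ≤ n → (l ≤ A ∨ A + m < l) → σ l = τ l) :
    (Finset.Icc 1 m).image (fun j => σ (A + j)) = (Finset.Icc 1 m).image (fun j => τ (A + j)) :=
  (window_sub σ τ n A m hσ hτ hA hagree).antisymm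
    (window_sub τ σ n A m hτ hσ hA (fun l h1 h2 h3 => (hagree l h1 h2 h3).symm))

/-! ### Assembling the proof -/

theorem rowSum_eq (s P k n : ℕ) (hs : 1 ≤ s) (hk : 1 ≤ k) (σ : ℕ → ℕ)
    (hσ : Set.BijOn σ (Set.Icc 1 n) (Set.Icc 1 n)) (hA : (k-1)*(P*s) + 2*P*s ≤ n) :
    rowSumBeta s P (fun j => σ ((k-1)*(P*s) + j))
      = ∑ j ∈ Finset.Ico ((k-1)*P+1) ((k-1)*P+1+2*P),
        rk ((Finset.Icc 1 (2*P*s)).image (fun j => σ ((k-1)*(P*s) + j))) (row1 s σ j) := by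
  rw [Finset.sum_Ico_eq_sum_range]
  unfold rowSumBeta
  have e : (k-1)*P+1+2*P - ((k-1)*P+1) = 2 * P := by omega
  rw [e]
  apply Finset.sum_congr rfl
  intro i hi
  rw [Finset.mem_range] at hi
  have h1 : i * s + s ≤ 2 * P * s := by
    have := Nat.mul_le_mul_right s (Nat.succ_le_of_lt hi)
    rwa [Nat.succ_mul] at this
  rw [betaProj_eq _ _ _ (window_inj σ n _ _ hσ hA) (by omega) (by omega)]
  congr 1
  unfold row1
  congr 1
  have : (k-1)*P+1+i-1 = (k-1)*P + i := by omega
  rw [this]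
  ring

theorem stmt_le (s t n : ℕ) (hs : 1 ≤ s) (ht : Even t) (ht1 : 1 ≤ t) (hn : n = s * t)
    (P : ℕ) (hP : P = Nat.clog 2 (4*n/s)) (hdvd : 2*P*s ∣ n)
    (a c1 c2 d1 d2 : ℕ)
    (σ τ : ℕ → ℕ)
    (hσperm : Set.BijOn σ (Set.Icc 1 n) (Set.Icc 1 n))
    (hτperm : Set.BijOn τ (Set.Icc 1 n) (Set.Icc 1 n))
    (hVTσ : (∑ i ∈ Finset.Icc 1 (t-1), i * sig (row1 s σ) i) ≡ a [MOD t])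
    (hVTτ : (∑ i ∈ Finset.Icc 1 (t-1), i * sig (row1 s τ) i) ≡ a [MOD t])
    (hrunσ : NoRun (t-1) P (sig (row1 s σ)))
    (hretσ : CRetrieve n s P c1 c2 σ) (hretτ : CRetrieve n s P c1 c2 τ)
    (hrecσ : CRecover n s d1 d2 σ) (hrecτ : CRecover n s d1 d2 τ)
    (i i' : ℕ) (hi : 1 ≤ i)
    (hi' : 1 ≤ i') (hi2' : i' + s - 1 ≤ n) (hii : i ≤ i')
    (hdel : BurstDelEq n s σ τ i i') :
    ∀ l ∈ Finset.Icc 1 n, σ l = τ l := by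
  have ht2 : 2 ≤ t := by
    obtain ⟨r, hr⟩ := ht; omega
  -- parameters
  have hP3 : 3 ≤ P := by
    rw [hP, hn]
    have e : 4 * (s * t) / s = 4 * t := by
      rw [show 4 * (s * t) = s * (4 * t) by ring]
      exact Nat.mul_div_cancel_left _ hs
    rw [e]
    have : Nat.clog 2 (2^3) ≤ Nat.clog 2 (4*t) := Nat.clog_mono_right 2 (by omega)
    rwa [Nat.clog_pow 2 3 (by omega)] at this
  obtain ⟨H, hH⟩ := hdvd
  have htH : t = 2 * P * H := by
    apply Nat.eq_of_mul_eq_mul_left hs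
    rw [← hn, hH]; ring
  have hH1 : 1 ≤ H := by
    rcases Nat.eq_zero_or_pos H with h | h
    · rw [h] at htH; omega
    · exact h
  obtain ⟨h, hh⟩ : ∃ h, t = 2 * h := ⟨P * H, by rw [htH]; ring⟩
  have hnt : n = (t - 1) * s + s := by
    obtain ⟨t, rfl⟩ : ∃ t', t = t' + 1 := ⟨t - 1, by omega⟩
    rw [hn]; simp; ring
  -- agreement of σ and τ outside the burst area
  have hlow : ∀ l, 1 ≤ l → l < i → σ l = τ l := by
    intro l hl hl2
    have := hdel l (by rw [Finset.mem_Icc]; omega)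
    rwa [if_pos hl2, if_pos (by omega)] at this
  have hhigh : ∀ l, l ≤ n → i' + s ≤ l → σ l = τ l := by
    intro l hl hl2
    have := hdel (l - s) (by rw [Finset.mem_Icc]; omega)
    rw [if_neg (by omega), if_neg (by omega)] at this
    have e : l - s + s = l := by omega
    rwa [e] at this
  -- column positions
  have hpos : ∀ i, 1 ≤ i → i + s - 1 ≤ n → ∃ p, 1 ≤ p ∧ p ≤ t ∧ i ≤ (p-1)*s+1 ∧
      (2 ≤ p → (p-2)*s+1 < i) ∧ (∀ j, 1 ≤ j → ((j-1)*s+1 < i ↔ j < p)) := by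
    intro i hi hin
    have hdm := Nat.div_add_mod (i+s-2) s
    have hml := Nat.mod_lt (i+s-2) hs
    generalize (i+s-2)/s = d at *
    generalize (i+s-2)%s = r at *
    rw [mul_comm] at hdm
    have hub : i ≤ d*s+1 := by omega
    have hlb : 1 ≤ d → (d-1)*s+1 < i := by
      intro hd
      obtain ⟨d, rfl⟩ : ∃ t', d = t' + 1 := ⟨d - 1, by omega⟩
      rw [Nat.succ_mul] at hdm
      simp only [Nat.add_sub_cancel]
      omega
    refine ⟨d+1, by omega, ?_, by simpa using hub, ?_, ?_⟩
    · by_contra hc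
      have h1 := hlb (by omega)
      have h2 := Nat.mul_le_mul_right s (show t - 1 ≤ d - 1 by omega)
      omega
    · intro h2
      exact hlb (by omega)
    · intro j hj
      constructor
      · intro hlt
        by_contra hc
        have := Nat.mul_le_mul_right s (show d ≤ j - 1 by omega)
        omega
      · intro hlt
        have := Nat.mul_le_mul_right s (show j - 1 ≤ d - 1 by omega)
        by_cases hd : 1 ≤ d
        · have := hlb hd
          omega
        · omega
  obtain ⟨p, hp1, hpt, hpu, hpl, hpj⟩ := hpos i hi (by omega)
  obtain ⟨p', hp1', hpt', hpu', hpl', hpj'⟩ := hpos i' hi' hi2'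
  have hpp : p ≤ p' := by
    by_contra hc
    have := (hpj p' hp1').mpr (by omega)
    omega
  -- deletion on the first row
  set x := row1 s σ with hx
  set y := row1 s τ with hy
  have hrow : ∀ j, 1 ≤ j → j ≤ t - 1 →
      (if j < p then x j else x (j+1)) = (if j < p' then y j else y (j+1)) := by
    intro j hj hjt
    have hmul := Nat.mul_le_mul_right s (show j ≤ t - 1 from hjt)
    have hjs : (j-1)*s + s = j * s := by
      obtain ⟨j, rfl⟩ : ∃ t', j = t' + 1 := ⟨j - 1, by omega⟩
      rw [Nat.succ_mul]; simp
    have hd := hdel ((j-1)*s+1) (by rw [Finset.mem_Icc]; omega)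
    simp only [hpj j hj, hpj' j hj] at hd
    have e : (j-1)*s+1+s = (j+1-1)*s+1 := by
      rw [Nat.add_sub_cancel]; omega
    rw [e] at hd
    exact hd
  have hr1 : ∀ j, 1 ≤ j → j < p → x j = y j := by
    intro j hj hj2
    have := hrow j hj (by omega)
    rwa [if_pos hj2, if_pos (by omega)] at this
  have hr2 : ∀ j, p ≤ j → j < p' → x (j+1) = y j := by
    intro j hj hj2
    have := hrow j (by omega) (by omega)
    rwa [if_neg (by omega), if_pos (by omega)] at this
  have hr3 : ∀ j, p' < j → j ≤ t → x j = y j := by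
    intro j hj hj2
    obtain ⟨j, rfl⟩ : ∃ t', j = t' + 1 := ⟨j - 1, by omega⟩
    have := hrow j (by omega) (by omega)
    rwa [if_neg (by omega), if_neg (by omega)] at this
  -- equal signatures
  obtain ⟨q, hq1, hqt, hqp, hqd⟩ := sig_del t p ht2 hp1 hpt x
  obtain ⟨q', hq1', hqt', hqp', hqd'⟩ := sig_del t p' ht2 hp1' hpt' y
  have hsd : ∀ j, 1 ≤ j → j ≤ t - 1 - 1 →
      (if j < q then sig x j else sig x (j+1)) = (if j < q' then sig y j else sig y (j+1)) := by
    intro j hj hjt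
    rw [← hqd j hj (by omega), ← hqd' j hj (by omega)]
    have hcong : ∀ u v : ℕ → ℕ, u j = v j → u (j+1) = v (j+1) → sig u j = sig v j := by
      intro u v h1 h2
      unfold sig
      rw [h1, h2]
    exact hcong _ _ (hrow j hj (by omega)) (hrow (j+1) (by omega) (by omega))
  have hmodt : ∑ j ∈ Finset.Icc 1 (t-1), j * sig x j ≡
      ∑ j ∈ Finset.Icc 1 (t-1), j * sig y j [MOD t-1+1] := by
    rw [show t - 1 + 1 = t by omega]
    exact hVTσ.trans hVTτ.symm
  obtain ⟨hsig, hcst⟩ := vt_two (t-1) q q' (sig x) (sig y) (sig_le_one x) (sig_le_one y)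
    hq1 hqt hq1' hqt' hsd hmodt
  -- the run bound
  have hqq : q' + 2 ≤ q + P := by
    by_contra hc
    obtain ⟨j, hj1, hj2, hj3⟩ := hrunσ q hq1 (by omega)
    apply hj3
    rw [hcst j hj1 (by omega), hcst (j+1) (by omega) (by omega)]
  have hppP : p' + 1 ≤ p + P := by omega
  -- the window of two big blocks
  have hxinj : ∀ j k, 1 ≤ j → j ≤ t → 1 ≤ k → k ≤ t → x j = x k → j = k := by
    intro j k hj hjt hk hkt hjk
    have h1 := Nat.mul_le_mul_right s (show j - 1 ≤ t - 1 by omega)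
    have h2 := Nat.mul_le_mul_right s (show k - 1 ≤ t - 1 by omega)
    have := hσperm.injOn (Set.mem_Icc.mpr (by omega)) (Set.mem_Icc.mpr (by omega)) hjk
    have h3 : (j - 1) * s = (k - 1) * s := by omega
    have := Nat.eq_of_mul_eq_mul_right hs h3
    omega
  -- general agreement outside a range of columns
  have hagr : ∀ B E, B + 1 ≤ p → (2 ≤ p → B + 2 ≤ p) → p' ≤ E → ∀ l, 1 ≤ l → l ≤ n →
      (l ≤ B * s ∨ E * s < l) → σ l = τ l := by
    intro B E hB hB2 hE l hl hln hor
    rcases hor with h1 | h1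
    · apply hlow l hl
      by_cases hp2 : 2 ≤ p
      · have := Nat.mul_le_mul_right s (show B ≤ p - 2 by have := hB2 hp2; omega)
        have := hpl hp2
        omega
      · have : B = 0 := by omega
        rw [this] at h1
        omega
    · apply hhigh l hln
      have := Nat.mul_le_mul_right s hE
      have hjs : (p'-1)*s + s = p' * s := by
        obtain ⟨j, hj⟩ : ∃ t', p' = t' + 1 := ⟨p' - 1, by omega⟩
        rw [hj, Nat.succ_mul]; simp
      omega
  obtain ⟨k, hk1, hkT, hkB, hkB2, hkE⟩ : ∃ k, 1 ≤ k ∧ k < 2 * H ∧ (k-1)*P + 1 ≤ p ∧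
      (2 ≤ p → (k-1)*P + 2 ≤ p) ∧ p' ≤ (k+1)*P := by
    have hdm := Nat.div_add_mod (p-2) P
    have hml := Nat.mod_lt (p-2) (show 0 < P by omega)
    rw [mul_comm] at hdm
    generalize (p-2)/P = d at *
    generalize (p-2)%P = r at *
    have hd1 : (d+1)*P = d*P+P := Nat.succ_mul _ _
    have hd2 : (d+1+1)*P = d*P+P+P := by rw [Nat.succ_mul, Nat.succ_mul]
    by_cases hd : d + 1 < 2 * H
    · refine ⟨d+1, by omega, hd, ?_, ?_, ?_⟩
      · simp only [Nat.add_sub_cancel]; omega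
      · simp only [Nat.add_sub_cancel]; omega
      · rw [hd2]; omega
    · have hm := Nat.mul_le_mul_right P (show 2 * H - 1 ≤ d by omega)
      obtain ⟨G, rfl⟩ : ∃ G, H = G + 1 := ⟨H - 1, by omega⟩
      have e1 : 2 * (G + 1) - 1 = 2 * G + 1 := by omega
      have e2 : (2 * G + 1) * P = 2 * G * P + P := Nat.succ_mul _ _
      have e3 : t = 2 * G * P + P + P := by rw [htH]; ring
      rw [e1, e2] at hm
      refine ⟨2*G+1, by omega, by omega, ?_, ?_, ?_⟩
      · simp only [Nat.add_sub_cancel]; omega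
      · simp only [Nat.add_sub_cancel]; omega
      · rw [Nat.succ_mul, e2]; omega
  have hkk : (k+1)*P = (k-1)*P + 2*P := by
    obtain ⟨j, rfl⟩ : ∃ t', k = t' + 1 := ⟨k - 1, by omega⟩
    simp only [Nat.add_sub_cancel]; ring
  have hkt : (k+1)*P ≤ t := by
    have := Nat.mul_le_mul_right P (show k + 1 ≤ 2 * H by omega)
    rw [htH]
    calc (k+1)*P ≤ 2*H*P := this
      _ = 2 * P * H := by ring
  have hPs : 0 < P * s := Nat.mul_pos (by omega) hs
  have hdiv1 : n / (2*P*s) = H := by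
    rw [hH]
    apply Nat.mul_div_cancel_left
    rw [mul_assoc]; omega
  have hdiv2 : n / (P*s) = 2 * H := by
    rw [hH, show 2*P*s*H = (P*s)*(2*H) by ring]
    exact Nat.mul_div_cancel_left _ hPs
  have hval : x p = y p' := by
    have hwin : ∀ l, 1 ≤ l → l ≤ n → (l ≤ (k-1)*(P*s) ∨ (k+1)*(P*s) < l) → σ l = τ l := by
      rw [← mul_assoc, ← mul_assoc]
      exact hagr _ _ hkB hkB2 hkE
    obtain ⟨hσ1, hσ2⟩ := hretσ
    obtain ⟨hτ1, hτ2⟩ := hretτ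
    rw [hdiv1, hdiv2] at hσ1 hσ2 hτ1 hτ2
    have hmod := pair_mod σ τ (P*s) (2*H) H (2*P*s) k c1 c2 (rowSumBeta s P)
      (rowSumBeta_congr s P hs) rfl hk1 hkT
      (by rw [show P*s*(2*H) = n by rw [hH]; ring]; exact hwin) hσ1 hτ1 hσ2 hτ2
    have hA : (k-1)*(P*s) + 2*P*s = (k+1)*(P*s) := by
      rw [← mul_assoc, ← mul_assoc, hkk]; ring
    have hAn : (k-1)*(P*s) + 2*P*s ≤ n := by
      rw [hA, ← mul_assoc, hn, mul_comm s t]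
      exact Nat.mul_le_mul_right s hkt
    have himg := window_img σ τ n ((k-1)*(P*s)) (2*P*s) hσperm hτperm hAn (by rw [hA]; exact hwin)
    have hcard : ((Finset.Icc 1 (2*P*s)).image (fun j => σ ((k-1)*(P*s) + j))).card = 2*P*s := by
      rw [Finset.card_image_of_injOn (window_inj σ n _ _ hσperm hAn)]; simp
    rw [rowSum_eq s P k n hs hk1 σ hσperm hAn, rowSum_eq s P k n hs hk1 τ hτperm hAn,
      ← himg] at hmod
    have hmem : ∀ u : ℕ → ℕ, ∀ j, (k-1)*P + 1 ≤ j → j ≤ (k+1)*P → row1 s u j ∈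
        (Finset.Icc 1 (2*P*s)).image (fun j => u ((k-1)*(P*s) + j)) := by
      intro u j hj1 hj2
      rw [Finset.mem_image]
      obtain ⟨e, he⟩ := Nat.exists_eq_add_of_le hj1
      have hes := Nat.mul_le_mul_right s (show e + 1 ≤ 2 * P by omega)
      rw [Nat.succ_mul] at hes
      refine ⟨e*s+1, by rw [Finset.mem_Icc]; omega, ?_⟩
      unfold row1
      congr 1
      rw [he, show (k-1)*P+1+e-1 = (k-1)*P+e by omega]
      ring
    have hxm := hmem σ p hkB (by omega)
    have hym := hmem τ p' (by omega) hkE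
    rw [← himg] at hym
    rw [← hx] at hxm
    rw [← hy] at hym
    rw [← hx, ← hy] at hmod
    generalize (Finset.Icc 1 (2*P*s)).image (fun j => σ ((k-1)*(P*s) + j)) = S at *
    have hmove := sum_move (rk S) x y ((k-1)*P+1) p p' ((k-1)*P+1+2*P) hkB hpp (by omega)
      (fun j hj hj2 => hr1 j (by omega) hj2) hr2 (fun j hj hj2 => hr3 j hj (by omega))
    have hm2 := hmod.add_right (rk S (y p'))
    rw [hmove] at hm2
    have hm3 := Nat.ModEq.add_left_cancel' _ hm2
    have b1 := rk_le S _ hxm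
    have b2 := rk_le S _ hym
    apply rk_inj S _ _ hxm hym
    have : ∀ z, ∃ w, rk S z = w + 1 := fun z => ⟨_, rfl⟩
    obtain ⟨w1, hw1⟩ := this (x p)
    obtain ⟨w2, hw2⟩ := this (y p')
    rw [hw1, hw2] at hm3
    have := Nat.ModEq.eq_of_lt_of_lt (Nat.ModEq.add_right_cancel' 1 hm3) (by omega) (by omega)
    omega
  -- the deleted position of the first row is determined
  have hpe : p = p' := row_fixed t p p' x y hp1 hpp hpt' hxinj hr2 hsig hval
  -- final recovery on two adjacent columns
  obtain ⟨b, hb1, hbt, hbB, hbB2, hbE⟩ : ∃ b, 1 ≤ b ∧ b < t ∧ b - 1 + 1 ≤ p ∧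
      (2 ≤ p → b - 1 + 2 ≤ p) ∧ p' ≤ b + 1 := by
    by_cases hp2 : 2 ≤ p
    · exact ⟨p - 1, by omega, by omega, by omega, by omega, by omega⟩
    · exact ⟨1, by omega, by omega, by omega, by omega, by omega⟩
  have hwin := hagr _ _ hbB hbB2 hbE
  have hdiv3 : n / (2*s) = h := by
    rw [hn, hh, show s*(2*h) = (2*s)*h by ring]
    exact Nat.mul_div_cancel_left _ (by omega)
  have hdiv4 : n / s = t := by
    rw [hn]; exact Nat.mul_div_cancel_left _ hs
  obtain ⟨hσ1, hσ2⟩ := hrecσ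
  obtain ⟨hτ1, hτ2⟩ := hrecτ
  rw [hdiv3, hdiv4] at hσ1 hσ2 hτ1 hτ2
  have hmod := pair_mod σ τ s t h (Nat.factorial (2*s)) b d1 d2 (fun v => permRank v (2*s))
    (permRank_congr (2*s)) hh hb1 hbt (by rw [← hn]; exact hwin) hσ1 hτ1 hσ2 hτ2
  have hA : (b-1)*s + 2*s = (b+1)*s := by
    obtain ⟨j, rfl⟩ : ∃ t', b = t' + 1 := ⟨b - 1, by omega⟩
    simp only [Nat.add_sub_cancel]; ring
  have hAn : (b-1)*s + 2*s ≤ n := by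
    rw [hA, hn, mul_comm s t]
    exact Nat.mul_le_mul_right s hbt
  have hfin := permRank_recover (2*s) _ _ (window_inj σ n _ _ hσperm hAn)
    (window_inj τ n _ _ hτperm hAn)
    (window_img σ τ n ((b-1)*s) (2*s) hσperm hτperm hAn (by rw [hA]; exact hwin)) hmod
  intro l hl
  rw [Finset.mem_Icc] at hl
  by_cases hc : l ≤ (b-1)*s ∨ (b+1)*s < l
  · exact hwin l hl.1 hl.2 hc
  · have := hfin (l - (b-1)*s) (by omega) (by omega)
    rwa [show (b-1)*s + (l - (b-1)*s) = l by omega] at this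

/-- Theorem: C_s^1 is an s-BSD permutation code. -/
theorem stmt7 (s t n : ℕ) (hs : 1 ≤ s) (ht : Even t) (ht1 : 1 ≤ t) (hn : n = s * t)
    (P : ℕ) (hP : P = Nat.clog 2 (4*n/s)) (hdvd : 2*P*s ∣ n)
    (a : ℕ) (ha : a < t)
    (c1 c2 : ℕ) (hc1 : c1 < 2*P*s) (hc2 : c2 < 2*P*s)
    (d1 d2 : ℕ) (hd1 : d1 < Nat.factorial (2*s)) (hd2 : d2 < Nat.factorial (2*s))
    (σ τ : ℕ → ℕ)
    (hσperm : Set.BijOn σ (Set.Icc 1 n) (Set.Icc 1 n))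
    (hτperm : Set.BijOn τ (Set.Icc 1 n) (Set.Icc 1 n))
    -- (i) first-row signature in VT_a(t-1)
    (hVTσ : (∑ i ∈ Finset.Icc 1 (t-1), i * sig (row1 s σ) i) ≡ a [MOD t])
    (hVTτ : (∑ i ∈ Finset.Icc 1 (t-1), i * sig (row1 s τ) i) ≡ a [MOD t])
    -- (ii) good permutations: every run of the first-row signature has length ≤ P-1
    (hrunσ : NoRun (t-1) P (sig (row1 s σ)))
    (hrunτ : NoRun (t-1) P (sig (row1 s τ)))
    -- (iii) C^retrieve
    (hretσ : CRetrieve n s P c1 c2 σ) (hretτ : CRetrieve n s P c1 c2 τ)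
    -- (iv) C^recover
    (hrecσ : CRecover n s d1 d2 σ) (hrecτ : CRecover n s d1 d2 τ)
    (i i' : ℕ) (hi : 1 ≤ i) (hi2 : i + s - 1 ≤ n)
    (hi' : 1 ≤ i') (hi2' : i' + s - 1 ≤ n)
    (hdel : BurstDelEq n s σ τ i i') :
    ∀ l ∈ Finset.Icc 1 n, σ l = τ l := by
  rcases le_total i i' with h | h
  · exact stmt_le s t n hs ht ht1 hn P hP hdvd a c1 c2 d1 d2 σ τ hσperm hτperm hVTσ hVTτ hrunσ
      hretσ hretτ hrecσ hrecτ i i' hi hi' hi2' h hdel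
  · intro l hl
    exact (stmt_le s t n hs ht ht1 hn P hP hdvd a c1 c2 d1 d2 τ σ hτperm hσperm hVTτ hVTσ hrunτ
      hretτ hretσ hrecτ hrecσ i' i hi' hi hi2 h (fun j hj => (hdel j hj).symm) l hl).symm

end Stmt
end

section
/- Let r, w, s, t be positive integers with n = rw = st, and let P = ⌈log₂(4n/s)⌉. Assume P+1 ≥ 2^{2r} and that r divides P+1. Then the number of sequences σ ∈ S_n^{(r,…,r)} (length-n sequences over the alphabet {1,…,w} in which each symbol appears exactly r times) such that every run of the binary sequence α(σ_{(s,1)}) has length at most P−1 is at least n!/(2·(r!)^w). -/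
namespace Stmt

open Finset in
lemma card_comp_eq_le {α β : Type*} [Fintype α] [DecidableEq α] [Fintype β] [DecidableEq β]
    (f h : α → β) :
    #{g : Equiv.Perm α | f ∘ g = h} ≤ ∏ b, (Nat.factorial #{a | f a = b}) := by
  classical
  rcases Finset.eq_empty_or_nonempty ({g : Equiv.Perm α | f ∘ g = h} : Finset _) with he | ⟨g0, hg0⟩
  · rw [he]; simp
  · have h1 := DomMulAct.stabilizer_card f
    have h2 : ∏ b, (Nat.factorial #{a | f a = b})
        = #{g : Equiv.Perm α | f ∘ g = f} := by
      rw [← Fintype.card_subtype, h1]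
      refine Finset.prod_congr rfl fun b _ => ?_
      rw [Fintype.card_subtype]
    rw [h2]
    refine Finset.card_le_card_of_injOn (fun g => g * g0⁻¹) ?_ ?_
    · intro g hg
      simp only [coe_filter, mem_univ, true_and, Set.mem_ofPred_eq, mem_filter] at hg hg0 ⊢
      funext a
      have e1 := congrFun hg (g0⁻¹ a)
      have e2 := congrFun hg0 (g0⁻¹ a)
      simp only [Function.comp_apply, Equiv.Perm.coe_mul] at e1 e2 ⊢
      rw [e1, ← e2]; simp
    · intro a _ b _ hab
      simpa using hab

lemma fact_le_pow (r k : ℕ) (h : k ≤ r) : Nat.factorial k ≤ r ^ k :=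
  (Nat.factorial_le_pow k).trans (Nat.pow_le_pow_left h k)

open Finset in
lemma card_mono_le {m w r : ℕ} (x : Fin m → Fin w) (hx : ∀ v, #{a | x a = v} ≤ r) :
    #{g : Equiv.Perm (Fin m) | Monotone (x ∘ g)} ≤ r ^ m := by
  classical
  calc #{g : Equiv.Perm (Fin m) | Monotone (x ∘ g)}
      ≤ #{g : Equiv.Perm (Fin m) | x ∘ g = x ∘ Tuple.sort x} := by
        refine Finset.card_le_card fun g hg => ?_
        simp only [mem_filter, mem_univ, true_and] at hg ⊢
        exact Tuple.comp_sort_eq_comp_iff_monotone.mpr hg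
    _ ≤ ∏ b, (Nat.factorial #{a | x a = b}) := card_comp_eq_le _ _
    _ ≤ ∏ b, r ^ #{a | x a = b} := Finset.prod_le_prod' fun b _ => fact_le_pow _ _ (hx b)
    _ = r ^ m := by
        rw [Finset.prod_pow_eq_pow_sum, ← Finset.card_eq_sum_card_fiberwise (f := x) (t := univ)]
        · simp
        · intro a _; simp

open Finset in
lemma card_anti_le {m w r : ℕ} (x : Fin m → Fin w) (hx : ∀ v, #{a | x a = v} ≤ r) :
    #{g : Equiv.Perm (Fin m) | Antitone (x ∘ g)} ≤ r ^ m := by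
  classical
  refine le_trans (Finset.card_le_card ?_) (card_mono_le (r := r) (fun a => Fin.rev (x a)) ?_)
  · intro g hg
    simp only [mem_filter, mem_univ, true_and] at hg ⊢
    intro a b hab
    exact Fin.rev_le_rev.mpr (hg hab)
  · intro v
    refine le_trans (le_of_eq ?_) (hx (Fin.rev v))
    congr 1
    ext a
    simp only [mem_filter, mem_univ, true_and]
    constructor
    · intro h; rw [← h, Fin.rev_rev]
    · intro h; rw [h, Fin.rev_rev]

/-- sequences where each symbol appears exactly r times -/
def regSet (n w r : ℕ) : Finset (Fin n → Fin w) :=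
  Finset.univ.filter fun σ => ∀ v : Fin w, (Finset.univ.filter (fun i => σ i = v)).card = r

open Finset in
lemma regSet_comp {n w r : ℕ} {σ : Fin n → Fin w} (h : σ ∈ regSet n w r)
    (g : Equiv.Perm (Fin n)) : σ ∘ g ∈ regSet n w r := by
  simp only [regSet, mem_filter, mem_univ, true_and] at h ⊢
  intro v
  rw [← h v]
  refine Finset.card_bij (fun a _ => g a) ?_ ?_ ?_
  · intro a ha; simpa using ha
  · intro a _ b _ hab; simpa using hab
  · intro b hb; exact ⟨g.symm b, by simpa using hb, by simp⟩

open Finset in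
lemma fact_le_regSet {n w r : ℕ} (hn : n = r * w) :
    Nat.factorial n ≤ (Nat.factorial r) ^ w * #(regSet n w r) := by
  classical
  have e : Fin n ≃ Fin w × Fin r := Fintype.equivOfCardEq (by simp [hn, mul_comm])
  let σ : Fin n → Fin w := fun i => (e i).1
  have hf : ∀ v, #{i | σ i = v} = r := by
    intro v
    have : #{i | σ i = v} = #(univ : Finset (Fin r)) := by
      refine Finset.card_bij (fun a _ => (e a).2) (by simp) ?_ ?_
      · intro a ha b hb hab
        apply e.injective
        simp only [mem_filter, mem_univ, true_and, σ] at ha hb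
        exact Prod.ext (ha.trans hb.symm) hab
      · intro b _; exact ⟨e.symm (v, b), by simp [σ], by simp⟩
    simpa using this
  have hσ : σ ∈ regSet n w r := by simpa [regSet] using hf
  have := Finset.card_le_mul_card_image_of_maps_to (s := (univ : Finset (Equiv.Perm (Fin n))))
    (t := regSet n w r) (f := fun g : Equiv.Perm (Fin n) => σ ∘ g) (fun g _ => regSet_comp hσ g)
    ((Nat.factorial r) ^ w) (by
      intro ρ _
      refine (card_comp_eq_le σ ρ).trans (le_of_eq ?_)
      simp [hf])
  simpa [Fintype.card_perm] using this

open Finset in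
lemma window_bound {n w r m : ℕ} (p : Fin m ↪ Fin n) (Q : (Fin m → Fin w) → Prop)
    [DecidablePred Q]
    (hQ : ∀ x : Fin m → Fin w, (∀ v, #{a | x a = v} ≤ r) →
      #{g : Equiv.Perm (Fin m) | Q (x ∘ g)} ≤ r ^ m) :
    #{σ ∈ regSet n w r | Q (σ ∘ p)} * Nat.factorial m ≤ #(regSet n w r) * r ^ m := by
  classical
  have h1 := Finset.sum_card_bipartiteAbove_eq_sum_card_bipartiteBelow
    (s := regSet n w r) (t := (univ : Finset (Equiv.Perm (Fin m))))
    (fun (σ : Fin n → Fin w) (g : Equiv.Perm (Fin m)) => Q ((σ ∘ p) ∘ g))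
  have h2 : ∑ σ ∈ regSet n w r, #(Finset.bipartiteAbove (fun (σ : Fin n → Fin w) (g : Equiv.Perm (Fin m)) => Q ((σ ∘ p) ∘ g))
      (univ : Finset (Equiv.Perm (Fin m))) σ) ≤ #(regSet n w r) * r ^ m := by
    refine (Finset.sum_le_card_nsmul _ _ (r ^ m) ?_).trans (by simp)
    intro σ hσ
    refine hQ (σ ∘ p) fun v => ?_
    simp only [regSet, mem_filter, mem_univ, true_and] at hσ
    rw [← hσ v]
    refine Finset.card_le_card_of_injOn p ?_ p.injective.injOn
    intro a ha
    simpa using ha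
  have h3 : Nat.factorial m * #{σ ∈ regSet n w r | Q (σ ∘ p)} ≤
      ∑ g : Equiv.Perm (Fin m), #(Finset.bipartiteBelow (fun (σ : Fin n → Fin w) (g : Equiv.Perm (Fin m)) => Q ((σ ∘ p) ∘ g))
      (regSet n w r) g) := by
    have := Finset.card_nsmul_le_sum (univ : Finset (Equiv.Perm (Fin m)))
      (fun g => #(Finset.bipartiteBelow (fun (σ : Fin n → Fin w) (g : Equiv.Perm (Fin m)) =>
        Q ((σ ∘ p) ∘ g)) (regSet n w r) g))
      #{σ ∈ regSet n w r | Q (σ ∘ p)} (by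
        intro g _
        refine Finset.card_le_card_of_injOn
          (fun σ => σ ∘ (g⁻¹.viaFintypeEmbedding p)) ?_ ?_
        · intro σ hσ
          simp only [coe_filter, Set.mem_ofPred_eq] at hσ
          simp only [bipartiteBelow, coe_filter, Set.mem_ofPred_eq]
          refine ⟨regSet_comp hσ.1 _, ?_⟩
          convert hσ.2 using 1
          funext a
          simp
        · intro a _ b _ hab
          exact (Equiv.surjective _).injective_comp_right hab)
    simpa [Fintype.card_perm] using this
  rw [mul_comm]
  exact h3.trans (h1 ▸ h2)

lemma four_pow_ge (r : ℕ) (hr : 2 ≤ r) : 6 * r ≤ 2 ^ (2 * r) := by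
  induction r, hr using Nat.le_induction with
  | base => norm_num
  | succ k hk ih =>
    have : 2 ^ (2 * (k + 1)) = 4 * 2 ^ (2 * k) := by ring
    omega

lemma num_bound (r m : ℕ) (hr : 1 ≤ r) (hm : 2 ^ (2 * r) ≤ m) :
    (2 * r) ^ m ≤ 2 * Nat.factorial m := by
  rcases Nat.lt_or_ge r 2 with h | h
  · have : r = 1 := by omega
    subst this
    have hm1 : 1 ≤ m := le_trans (by norm_num) hm
    clear hm
    induction m, hm1 using Nat.le_induction with
    | base => norm_num
    | succ k hk ih =>
      rw [Nat.factorial_succ, pow_succ]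
      nlinarith
  · have h6 : 6 * r ≤ m := (four_pow_ge r h).trans hm
    have h1 : (m : ℝ) ^ m / (Nat.factorial m) ≤ Real.exp m :=
      Real.pow_div_factorial_le_exp _ (by positivity) m
    have h2 : Real.exp m ≤ 3 ^ m := by
      rw [← Real.exp_one_pow]
      exact pow_le_pow_left₀ (Real.exp_pos _).le (Real.exp_one_lt_d9.le.trans (by norm_num)) m
    have h3 : (m : ℝ) ^ m ≤ 3 ^ m * Nat.factorial m := by
      rw [div_le_iff₀ (by positivity)] at h1
      exact h1.trans (by gcongr)
    have h3' : m ^ m ≤ 3 ^ m * Nat.factorial m := by exact_mod_cast h3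
    have h4 : (3 * (2 * r)) ^ m ≤ m ^ m := Nat.pow_le_pow_left (by omega) m
    rw [mul_pow] at h4
    have h5 : (2 * r) ^ m ≤ Nat.factorial m :=
      Nat.le_of_mul_le_mul_left (h4.trans h3') (by positivity)
    omega

/-- positions of a window -/
def win {s t n P : ℕ} (hs : 1 ≤ s) (hn : n = s * t) (i : Fin (t - P)) : Fin (P + 1) ↪ Fin n where
  toFun k := ⟨(i + k) * s, by
    have h1 := i.2
    have h2 := k.2
    have : (i : ℕ) + k < t := by omega
    rw [hn, mul_comm s t]
    exact Nat.mul_lt_mul_of_pos_right this hs⟩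
  inj' a b h := by
    have h' : ((i : ℕ) + a) * s = (i + b) * s := by simpa using h
    have := Nat.eq_of_mul_eq_mul_right hs h'
    exact Fin.ext (by omega)

lemma bad_window {w s t n P : ℕ} (hs : 1 ≤ s) (hn : n = s * t) (hP : 1 ≤ P) (σ : Fin n → Fin w)
    (hbad : ¬ NoRun (t-1) P (sig (row1 s
            (fun i => if h : i - 1 < n then (σ ⟨i-1, h⟩ : ℕ) + 1 else 0)))) :
    ∃ i : Fin (t - P), Monotone (σ ∘ win hs hn i) ∨ Antitone (σ ∘ win hs hn i) := by
  set u : ℕ → ℕ := fun i => if h : i - 1 < n then (σ ⟨i-1, h⟩ : ℕ) + 1 else 0 with hu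
  simp only [NoRun, not_forall, not_exists, not_and, not_not] at hbad
  obtain ⟨i, hi1, hi2, hc⟩ := hbad
  have hit : i - 1 < t - P := by omega
  have hconst : ∀ k, k < P → sig (row1 s u) (i + k) = sig (row1 s u) i := by
    intro k
    induction k with
    | zero => intro _; rfl
    | succ k ih =>
      intro hk
      rw [← ih (by omega)]
      exact (hc (i + k) (by omega) (by omega)).symm
  have hval : ∀ k : Fin (P + 1), row1 s u (i + k) = (σ (win hs hn ⟨i - 1, hit⟩ k) : ℕ) + 1 := by
    intro k
    have hlt : (i + k - 1) * s < n := by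
      have := (win hs hn ⟨i - 1, hit⟩ k).2
      have e : i + (k : ℕ) - 1 = i - 1 + k := by omega
      rw [e]; exact this
    have e : i + (k : ℕ) - 1 = i - 1 + k := by omega
    simp only [row1, hu, Nat.add_sub_cancel]
    rw [dif_pos hlt]
    simp only [win, e]
    rfl
  refine ⟨⟨i - 1, hit⟩, ?_⟩
  by_cases h0 : row1 s u i ≤ row1 s u (i + 1)
  · left
    rw [Fin.monotone_iff_le_succ]
    intro k
    have h1 := hconst k k.2
    have a := hval k.castSucc
    have b := hval k.succ
    simp only [Fin.val_castSucc, Fin.val_succ] at a b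
    simp only [sig, h0, if_true] at h1
    rw [add_assoc] at h1
    rw [a, b] at h1
    split_ifs at h1 with h2
    · exact Fin.le_def.mpr (by simpa using h2)
  · right
    rw [Fin.antitone_iff_succ_le]
    intro k
    have h1 := hconst k k.2
    have a := hval k.castSucc
    have b := hval k.succ
    simp only [Fin.val_castSucc, Fin.val_succ] at a b
    simp only [sig, h0, if_false] at h1
    rw [add_assoc] at h1
    rw [a, b] at h1
    split_ifs at h1 with h2
    · exact Fin.le_def.mpr (by simp only [Function.comp_apply]; omega)

/-- Lemma: the number of good regular multi-permutations is at least
n!/(2·(r!)^w), when P+1 ≥ 2^{2r} and r divides P+1. -/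
theorem stmt9 (r w s t n : ℕ) (hr : 1 ≤ r) (hw : 1 ≤ w) (hs : 1 ≤ s) (ht : 1 ≤ t)
    (hn1 : n = r * w) (hn2 : n = s * t)
    (P : ℕ) (hP : P = Nat.clog 2 (4*n/s))
    (hPbig : 2^(2*r) ≤ P + 1) (hPdvd : r ∣ P + 1) :
    Nat.factorial n ≤ 2 * (Nat.factorial r)^w *
      Nat.card {σ : Fin n → Fin w //
        (∀ v : Fin w, (Finset.univ.filter (fun i => σ i = v)).card = r)
        ∧ NoRun (t-1) P (sig (row1 s
            (fun i => if h : i - 1 < n then (σ ⟨i-1, h⟩ : ℕ) + 1 else 0)))} := by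
  classical
  have hP3 : 3 ≤ P := by
    have : 2 ^ (2 * 1) ≤ 2 ^ (2 * r) := Nat.pow_le_pow_right (by norm_num) (by omega)
    omega
  have h4 : 4 * n / s = 4 * t := by
    rw [hn2, show 4 * (s * t) = s * (4 * t) by ring, Nat.mul_div_cancel_left _ hs]
  have h4t : 4 * t ≤ 2 ^ P := by
    rw [hP, h4]; exact Nat.le_pow_clog (by norm_num) _
  have hnum := num_bound r (P + 1) hr hPbig
  set S := regSet n w r with hS
  let N : (Fin n → Fin w) → Prop := fun σ => NoRun (t-1) P (sig (row1 s
            (fun i => if h : i - 1 < n then (σ ⟨i-1, h⟩ : ℕ) + 1 else 0)))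
  have hcard : Nat.card {σ : Fin n → Fin w //
        (∀ v : Fin w, (Finset.univ.filter (fun i => σ i = v)).card = r)
        ∧ NoRun (t-1) P (sig (row1 s
            (fun i => if h : i - 1 < n then (σ ⟨i-1, h⟩ : ℕ) + 1 else 0)))}
      = (S.filter N).card := by
    rw [Nat.card_eq_fintype_card, Fintype.card_subtype, hS, regSet, Finset.filter_filter]
  rw [hcard]
  have hsplit := Finset.card_filter_add_card_filter_not (s := S) N
  have key : ∀ x : ℕ, x * Nat.factorial (P + 1) ≤ S.card * r ^ (P + 1) → x * 2 ^ P ≤ S.card := by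
    intro x hx
    have hf : 0 < Nat.factorial (P + 1) := Nat.factorial_pos _
    refine Nat.le_of_mul_le_mul_right (c := Nat.factorial (P + 1) * 2) ?_ (by positivity)
    calc x * 2 ^ P * (Nat.factorial (P + 1) * 2)
        = (x * Nat.factorial (P + 1)) * 2 ^ (P + 1) := by ring
      _ ≤ (S.card * r ^ (P + 1)) * 2 ^ (P + 1) := Nat.mul_le_mul_right _ hx
      _ = S.card * (2 * r) ^ (P + 1) := by rw [mul_pow]; ring
      _ ≤ S.card * (2 * Nat.factorial (P + 1)) := Nat.mul_le_mul_left _ hnum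
      _ = S.card * (Nat.factorial (P + 1) * 2) := by ring
  let A : Fin (t - P) → Finset (Fin n → Fin w) := fun i =>
    S.filter (fun σ => Monotone (σ ∘ win hs hn2 i))
  let D : Fin (t - P) → Finset (Fin n → Fin w) := fun i =>
    S.filter (fun σ => Antitone (σ ∘ win hs hn2 i))
  have hA : ∀ i, (A i).card * 2 ^ P ≤ S.card := fun i => key _ (by
    have := window_bound (w := w) (r := r) (win hs hn2 i) (fun x => Monotone x)
      (fun x hx => by convert card_mono_le x hx)
    convert this)
  have hD : ∀ i, (D i).card * 2 ^ P ≤ S.card := fun i => key _ (by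
    have := window_bound (w := w) (r := r) (win hs hn2 i) (fun x => Antitone x)
      (fun x hx => by convert card_anti_le x hx)
    convert this)
  have hsub : S.filter (fun σ => ¬ N σ) ⊆ Finset.univ.biUnion (fun i => A i ∪ D i) := by
    intro σ hσ
    rw [Finset.mem_filter] at hσ
    obtain ⟨i, hi⟩ := bad_window hs hn2 (by omega) σ hσ.2
    simp only [Finset.mem_biUnion, Finset.mem_univ, true_and, Finset.mem_union, A, D,
      Finset.mem_filter]
    exact ⟨i, hi.imp (fun h => ⟨hσ.1, h⟩) (fun h => ⟨hσ.1, h⟩)⟩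
  have hB : (S.filter (fun σ => ¬ N σ)).card * 2 ^ P ≤ t * (2 * S.card) := by
    calc (S.filter (fun σ => ¬ N σ)).card * 2 ^ P
        ≤ (∑ i, ((A i).card + (D i).card)) * 2 ^ P := by
          refine Nat.mul_le_mul_right _ ((Finset.card_le_card hsub).trans ?_)
          exact Finset.card_biUnion_le.trans (Finset.sum_le_sum fun i _ => Finset.card_union_le _ _)
      _ = ∑ i, ((A i).card * 2 ^ P + (D i).card * 2 ^ P) := by
          rw [Finset.sum_mul]; simp only [add_mul]
      _ ≤ ∑ i : Fin (t - P), 2 * S.card := by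
          refine Finset.sum_le_sum fun i _ => ?_
          have := hA i
          have := hD i
          omega
      _ = (t - P) * (2 * S.card) := by simp
      _ ≤ t * (2 * S.card) := Nat.mul_le_mul_right _ (Nat.sub_le _ _)
  have hB2 : 2 * (S.filter (fun σ => ¬ N σ)).card ≤ S.card := by
    refine Nat.le_of_mul_le_mul_left (c := 2 * t) ?_ (by omega)
    have h5 := Nat.mul_le_mul_left (S.filter (fun σ => ¬ N σ)).card h4t
    calc 2 * t * (2 * (S.filter (fun σ => ¬ N σ)).card)
        = (S.filter (fun σ => ¬ N σ)).card * (4 * t) := by ring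
      _ ≤ t * (2 * S.card) := h5.trans hB
      _ = 2 * t * S.card := by ring
  have hgood : S.card ≤ 2 * (S.filter N).card := by omega
  calc Nat.factorial n ≤ (Nat.factorial r) ^ w * S.card := fact_le_regSet hn1
    _ ≤ (Nat.factorial r) ^ w * (2 * (S.filter N).card) := Nat.mul_le_mul_left _ hgood
    _ = 2 * (Nat.factorial r) ^ w * (S.filter N).card := by ring

end Stmt
end
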